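/- Let r ∈ (−1/2, 0), set α = −1/r (so α > 2), and for each K ≥ 1 let b_r(ε) = q_ε(M_{r,K}(V_1,…,V_K)) where V_1,…,V_K are independent uniform random variables on [0,1]. Then for each fixed ε ∈ (0,1), b_r(ε) ∼ ((C_α Φ^{−1}(1−ε) + b_K)/K)^{1/r} as K → ∞, where C_α = (K(α/(α−2) − (α/(α−1))²))^{1/2}, b_K = Kα/(α−1), and Φ^{−1} is the standard normal quantile function; here A_K ∼ B_K means A_K/B_K → 1. -/

import Mathlib

open MeasureTheory ProbabilityTheory Real Set Filter

/-- The uniform probability measure on `[0,1]` (Lebesgue measure restricted to `[0,1]`). -/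
noncomputable def unif01 : MeasureTheory.Measure ℝ :=
  MeasureTheory.volume.restrict (Set.Icc (0:ℝ) 1)

instance : MeasureTheory.IsProbabilityMeasure unif01 := by
  constructor
  simp [unif01, Real.volume_Icc]

/-- `U` is uniformly distributed on `[0,1]` under `P`. -/
def IsUnif {Ω : Type*} [MeasurableSpace Ω] (P : MeasureTheory.Measure Ω) (U : Ω → ℝ) : Prop :=
  Measurable U ∧ MeasureTheory.Measure.map U P = unif01

/-- Left `ε`-quantile of a random variable `X` under `P`:
`q_ε(X) = inf {x : ε ≤ P(X ≤ x)}`. -/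
noncomputable def lQuantile {Ω : Type*} [MeasurableSpace Ω] (P : MeasureTheory.Measure Ω)
    (X : Ω → ℝ) (ε : ℝ) : ℝ :=
  sInf {x : ℝ | ε ≤ (P {ω | X ω ≤ x}).toReal}

/-- The measure `P` is atomless: every non-null measurable set has a measurable subset of
different, nonzero measure. -/
def Atomless {Ω : Type*} [MeasurableSpace Ω] (P : MeasureTheory.Measure Ω) : Prop :=
  ∀ A, MeasurableSet A → P A ≠ 0 →
    ∃ B, B ⊆ A ∧ MeasurableSet B ∧ P B ≠ 0 ∧ P B ≠ P A

/-- VAD threshold: infimum of left `ε`-quantiles of `F(U_1,…,U_K)` over all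
uniformly distributed `U_1,…,U_K` on `[0,1]` with arbitrary joint dependence. -/
noncomputable def VAD {Ω : Type*} [MeasurableSpace Ω] (P : MeasureTheory.Measure Ω) (K : ℕ)
    (F : (Fin K → ℝ) → ℝ) (ε : ℝ) : ℝ :=
  sInf {y : ℝ | ∃ U : Fin K → Ω → ℝ, (∀ i, IsUnif P (U i)) ∧
    y = lQuantile P (fun ω => F (fun i => U i ω)) ε}

/-- VI threshold: left `ε`-quantile of `F(V_1,…,V_K)` for independent uniforms,
realized via the product measure. -/
noncomputable def VI (K : ℕ) (F : (Fin K → ℝ) → ℝ) (ε : ℝ) : ℝ :=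
  lQuantile (MeasureTheory.Measure.pi fun _ : Fin K => unif01) F ε

/-- VC threshold: left `ε`-quantile of `F(U,…,U)` for a single uniform `U`. -/
noncomputable def VC (K : ℕ) (F : (Fin K → ℝ) → ℝ) (ε : ℝ) : ℝ :=
  lQuantile unif01 (fun u => F (fun _ => u)) ε

/-- generalized mean combining function `M_{r,K}` for `r ≠ 0`. -/
noncomputable def Mr (r : ℝ) (K : ℕ) (p : Fin K → ℝ) : ℝ :=
  ((∑ i, p i ^ r) / (K : ℝ)) ^ r⁻¹

/-- standard normal quantile function `Φ⁻¹`. -/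
noncomputable def normQuantile (p : ℝ) : ℝ :=
  sInf {x : ℝ | p ≤ ((ProbabilityTheory.gaussianReal 0 1) (Set.Iic x)).toReal}

open scoped Topology

lemma tendsto_lQuantile_of_tendsto_measureReal {Ω : ℕ → Type*} [∀ n, MeasurableSpace (Ω n)]
    {P : ∀ n, Measure (Ω n)} [∀ n, IsProbabilityMeasure (P n)] {X : ∀ n, Ω n → ℝ} {c ε : ℝ}
    (hε : ε ∈ Ioo (0 : ℝ) 1)
    (hX : ∀ δ > 0, Tendsto (fun n ↦ (P n).real {ω | δ ≤ |X n ω - c|}) atTop (𝓝 0)) :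
    Tendsto (fun n ↦ lQuantile (P n) (X n) ε) atTop (𝓝 c) := by
  rw [Metric.tendsto_atTop']
  intro η hη
  have hδ : 0 < η / 2 := half_pos hη
  obtain ⟨N, hN⟩ := eventually_atTop.1
    ((hX _ hδ).eventually_lt_const (lt_min hε.1 (sub_pos.2 hε.2)))
  refine ⟨N, fun n hn ↦ ?_⟩
  obtain ⟨h_lt, h_lt'⟩ := lt_min_iff.1 (hN n hn.le)
  have h_mem : c + η / 2 ∈ {x : ℝ | ε ≤ ((P n) {ω | X n ω ≤ x}).toReal} := by
    have h_cover : (univ : Set (Ω n)) ⊆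
        {ω | X n ω ≤ c + η / 2} ∪ {ω | η / 2 ≤ |X n ω - c|} := by
      intro ω _
      rcases le_total (X n ω) (c + η / 2) with h | h
      · exact Or.inl h
      · exact Or.inr ((by linarith : η / 2 ≤ X n ω - c).trans (le_abs_self _))
    have h_union := (measureReal_mono (μ := P n) h_cover).trans (measureReal_union_le _ _)
    rw [probReal_univ] at h_union
    change ε ≤ (P n).real _
    linarith
  have h_lower : ∀ x ∈ {x : ℝ | ε ≤ ((P n) {ω | X n ω ≤ x}).toReal}, c - η / 2 ≤ x := by
    intro x hx
    by_contra! hxc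
    have h_sub : {ω | X n ω ≤ x} ⊆ {ω | η / 2 ≤ |X n ω - c|} := by
      intro ω (hω : X n ω ≤ x)
      exact (by linarith : η / 2 ≤ -(X n ω - c)).trans (neg_le_abs _)
    have h_le := measureReal_mono (μ := P n) h_sub
    change ε ≤ (P n).real _ at hx
    linarith
  have h_upper : lQuantile (P n) (X n) ε ≤ c + η / 2 := csInf_le ⟨_, h_lower⟩ h_mem
  have h_ge : c - η / 2 ≤ lQuantile (P n) (X n) ε := le_csInf ⟨_, h_mem⟩ h_lower
  rw [Real.dist_eq, abs_lt]
  constructor <;> linarith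

lemma tendsto_measureReal_abs_sampleMean_sub {Ω : Type*} [MeasurableSpace Ω] {μ : Measure Ω}
    [IsProbabilityMeasure μ] {f : Ω → ℝ} (hf : MemLp f 2 μ) {δ : ℝ} (hδ : 0 < δ) :
    Tendsto (fun K : ℕ ↦ (Measure.pi fun _ : Fin K ↦ μ).real
      {p | δ ≤ |(∑ i, f (p i)) / K - ∫ x, f x ∂μ|}) atTop (𝓝 0) := by
  have h_lim : Tendsto (fun K : ℕ ↦ Var[f; μ] / δ ^ 2 / K) atTop (𝓝 0) :=
    tendsto_const_div_atTop_nhds_zero_nat _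
  refine squeeze_zero' (Eventually.of_forall fun _ ↦ measureReal_nonneg) ?_ h_lim
  filter_upwards [eventually_gt_atTop 0] with K hK
  have hK' : (0 : ℝ) < K := Nat.cast_pos.2 hK
  have h_memLp (i : Fin K) : MemLp (fun p : Fin K → Ω ↦ f (p i)) 2 (Measure.pi fun _ ↦ μ) :=
    hf.comp_measurePreserving (measurePreserving_eval _ i)
  have h_mean : ∫ p, (∑ i, fun p : Fin K → Ω ↦ f (p i)) p ∂(Measure.pi fun _ ↦ μ)
      = K * ∫ x, f x ∂μ := by
    simp only [Finset.sum_apply]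
    rw [integral_finsetSum _ fun i _ ↦ (h_memLp i).integrable one_le_two]
    have h_eval (i : Fin K) : ∫ p, f (p i) ∂(Measure.pi fun _ : Fin K ↦ μ) = ∫ x, f x ∂μ :=
      integral_comp_eval (μ := fun _ : Fin K ↦ μ) hf.aestronglyMeasurable
    simp [h_eval]
  have h_var := variance_sum_pi (μ := fun _ : Fin K ↦ μ) fun _ ↦ hf
  have h_cheb := meas_ge_le_variance_div_sq (memLp_finsetSum' Finset.univ fun i _ ↦ h_memLp i)
    (mul_pos hK' hδ)
  rw [h_mean, h_var] at h_cheb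
  have h_set : {p : Fin K → Ω | δ ≤ |(∑ i, f (p i)) / K - ∫ x, f x ∂μ|}
      = {p | K * δ ≤ |(∑ i, fun p : Fin K → Ω ↦ f (p i)) p - K * ∫ x, f x ∂μ|} := by
    ext p
    have h_eq : (∑ i, f (p i)) - K * ∫ x, f x ∂μ
        = K * ((∑ i, f (p i)) / K - ∫ x, f x ∂μ) := by
      field_simp
    simp [h_eq, abs_mul, hK']
  rw [h_set]
  refine (ENNReal.toReal_le_of_le_ofReal (by have := variance_nonneg f μ; positivity)
    h_cheb).trans_eq ?_
  simp only [Finset.sum_const, Finset.card_univ, Fintype.card_fin, nsmul_eq_mul]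
  field_simp

lemma memLp_rpow_unif01 {r : ℝ} (hr : -(1 / 2) < r) : MemLp (fun x : ℝ ↦ x ^ r) 2 unif01 := by
  rw [memLp_two_iff_integrable_sq (by fun_prop)]
  have h_int : IntegrableOn (fun x : ℝ ↦ x ^ (r * 2)) (Icc 0 1) :=
    (intervalIntegrable_iff_integrableOn_Icc_of_le zero_le_one).1
      (intervalIntegral.intervalIntegrable_rpow' (by linarith))
  refine h_int.congr_fun (fun x hx ↦ ?_) measurableSet_Icc
  exact_mod_cast Real.rpow_mul_natCast hx.1 r 2

lemma integral_rpow_unif01 {r : ℝ} (hr : -1 < r) : ∫ x, x ^ r ∂unif01 = (r + 1)⁻¹ := by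
  rw [unif01, integral_Icc_eq_integral_Ioc, ← intervalIntegral.integral_of_le zero_le_one,
    integral_rpow (Or.inl hr)]
  simp [Real.zero_rpow (by linarith : r + 1 ≠ 0)]

lemma tendsto_VI_Mr {r ε : ℝ} (hr : -(1 / 2) < r) (hε : ε ∈ Ioo (0 : ℝ) 1) :
    Tendsto (fun K : ℕ ↦ VI K (Mr r K) ε) atTop (𝓝 ((r + 1)⁻¹ ^ r⁻¹)) := by
  refine tendsto_lQuantile_of_tendsto_measureReal hε fun δ hδ ↦ ?_
  have h_pos : 0 < (r + 1)⁻¹ := inv_pos.2 (by linarith)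
  obtain ⟨η, hη, h_cont⟩ := Metric.continuousAt_iff.1
    (Real.continuousAt_rpow_const (r + 1)⁻¹ r⁻¹ (Or.inl h_pos.ne')) δ hδ
  refine squeeze_zero (fun _ ↦ measureReal_nonneg) (fun K ↦ measureReal_mono fun p hp ↦ ?_)
    (tendsto_measureReal_abs_sampleMean_sub (memLp_rpow_unif01 hr) hη)
  rw [integral_rpow_unif01 (by linarith)]
  by_contra h
  exact (h_cont (not_le.1 h)).not_ge hp

lemma tendsto_sqrt_mul_add_mul_div (v q m : ℝ) :
    Tendsto (fun K : ℕ ↦ (√(K * v) * q + K * m) / K) atTop (𝓝 m) := by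
  have h_inv : Tendsto (fun K : ℕ ↦ (√(K : ℝ))⁻¹) atTop (𝓝 0) :=
    tendsto_inv_atTop_zero.comp (Real.tendsto_sqrt_atTop.comp tendsto_natCast_atTop_atTop)
  have h_lim : Tendsto (fun K : ℕ ↦ (√(K : ℝ))⁻¹ * (√v * q) + m) atTop (𝓝 m) := by
    simpa using (h_inv.mul_const (√v * q)).add_const m
  refine h_lim.congr' ?_
  filter_upwards [eventually_gt_atTop 0] with K hK
  have hK' : (0 : ℝ) < K := Nat.cast_pos.2 hK
  rw [Real.sqrt_mul hK'.le, add_div, mul_div_cancel_left₀ _ hK'.ne', mul_assoc, mul_div_right_comm,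
    Real.sqrt_div_self]

/-- for `r ∈ (-1/2, 0)` and `α = -1/r > 2`, for fixed `ε ∈ (0,1)`,
`b_r(ε) ∼ ((C_α Φ⁻¹(1-ε) + b_K)/K)^{1/r}` as `K → ∞`, where
`C_α = (K(α/(α-2) - (α/(α-1))²))^{1/2}` and `b_K = Kα/(α-1)`. -/
theorem vi_asymptotic_large_K_r_neg_half (r : ℝ) (hr : r ∈ Set.Ioo (-(1/2) : ℝ) 0)
    (α : ℝ) (hα : α = -1/r) (ε : ℝ) (hε : ε ∈ Set.Ioo (0:ℝ) 1) :
    Filter.Tendsto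
      (fun K : ℕ => VI K (Mr r K) ε /
        (((Real.sqrt ((K : ℝ) * (α/(α-2) - (α/(α-1))^2)) * normQuantile (1 - ε)
            + (K : ℝ) * α/(α-1)) / (K : ℝ)) ^ r⁻¹))
      Filter.atTop (nhds 1) := by
  obtain ⟨hr₁, hr₀⟩ := hr
  have h_mean : α / (α - 1) = (r + 1)⁻¹ := by
    have hr_ne : r ≠ 0 := hr₀.ne
    have hr_add : r + 1 ≠ 0 := by linarith
    have : -1 / r - 1 ≠ 0 := by
      rw [div_sub_one hr_ne]
      exact div_ne_zero (by linarith) hr_ne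
    rw [hα, div_eq_iff this, inv_mul_eq_div, eq_div_iff hr_add]
    field_simp
    ring
  have h_pos : 0 < (r + 1)⁻¹ := inv_pos.2 (by linarith)
  have h_den := (tendsto_sqrt_mul_add_mul_div (α / (α - 2) - (α / (α - 1)) ^ 2)
    (normQuantile (1 - ε)) (α / (α - 1))).rpow_const (p := r⁻¹) (Or.inl (h_mean ▸ h_pos.ne'))
  have h_ne : (r + 1)⁻¹ ^ r⁻¹ ≠ 0 := (Real.rpow_pos_of_pos h_pos _).ne'
  have h_num := tendsto_VI_Mr hr₁ hε
  rw [← h_mean] at h_num h_ne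
  simpa only [div_self h_ne, mul_div_assoc, Pi.div_def] using h_num.div h_den h_ne
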